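/- arXiv:1203.0257 — 3 statements merged into one kernel-verified Lean document; each statement's English description precedes it below -/
import Mathlib

section
/- Let n be a positive integer and let F : ℝ₊ⁿ → ℝ₊ be an isotone metric preserving function. Then for all x = (x₁,…,xₙ) and y = (y₁,…,yₙ) in ℝ₊ⁿ, the inequality |F(x) − F(y)| ≤ F(|x − y|) holds, where |x − y| denotes the vector (|x₁ − y₁|,…,|xₙ − yₙ|). -/
open scoped NNReal

/-- `d` is a metric on `α`. -/
def IsMetric {α : Type*} (d : α → α → ℝ) : Prop :=
  (∀ x y, 0 ≤ d x y) ∧ (∀ x y, d x y = 0 ↔ x = y) ∧ (∀ x y, d x y = d y x) ∧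
    ∀ x y z, d x z ≤ d x y + d y z

/-- `F : ℝ₊ⁿ → ℝ₊` is a metric preserving function of `n` variables. -/
def MetricPreserving (n : ℕ) (F : (Fin n → ℝ≥0) → ℝ≥0) : Prop :=
  ∀ (Y : Fin n → Type*) [∀ i, MetricSpace (Y i)],
    IsMetric (fun x y : ∀ i, Y i => ((F fun i => nndist (x i) (y i) : ℝ≥0) : ℝ))

/-- Lemma 4.2. If `F : ℝ₊ⁿ → ℝ₊` is an isotone metric preserving
function, then `|F x − F y| ≤ F |x − y|` for all `x, y ∈ ℝ₊ⁿ`, where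
`|x − y| = (|x₁ − y₁|, …, |xₙ − yₙ|)`. -/
theorem stmt_13 (n : ℕ) (hn : 0 < n) (F : (Fin n → ℝ≥0) → ℝ≥0)
    (hmono : Monotone F) (hmp : MetricPreserving n F) (x y : Fin n → ℝ≥0) :
    |((F x : ℝ)) - ((F y : ℝ))| ≤ ((F fun i => nndist (x i) (y i) : ℝ≥0) : ℝ) := by
  obtain ⟨-, -, hsymm, htri⟩ := hmp (fun _ => ULift ℝ≥0)
  have hx := htri (fun _ => ULift.up 0) (fun i => ULift.up (y i)) (fun i => ULift.up (x i))
  have hy := htri (fun _ => ULift.up 0) (fun i => ULift.up (x i)) (fun i => ULift.up (y i))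
  have hs := hsymm (fun i => ULift.up (x i)) (fun i => ULift.up (y i))
  simp only [ULift.nndist_up_up, NNReal.nndist_zero_eq_val] at hx hy hs
  rw [abs_le]
  constructor <;> linarith
end

section
/- Let n be a positive integer and let F : ℝ₊ⁿ → ℝ₊ be an arbitrary nonnegative function. Then F is an isotone metric preserving function if and only if there exists a function g ∈ 𝒲 (i.e., a bornologous function g : ℝ₊ⁿ → ℝ₊ which is nonconstant with respect to every variable) such that F(ε̄) = ω(g,ε̄) for every ε̄ ∈ ℝ₊ⁿ, where ω(g,ε̄) = sup{ |g(x) − g(y)| : x, y ∈ ℝ₊ⁿ, |x − y| ≤ ε̄ } is the modulus of continuity of g. -/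
open scoped NNReal

/-- The family `𝒲`: bornologous functions `g : ℝ₊ⁿ → ℝ₊` (with the sup metric on `ℝ₊ⁿ`)
which are nonconstant with respect to every variable. -/
def MemW (n : ℕ) (g : (Fin n → ℝ≥0) → ℝ≥0) : Prop :=
  (∀ ε : ℝ≥0, ∃ δ : ℝ≥0, ∀ x y : Fin n → ℝ≥0,
      (∀ i, nndist (x i) (y i) ≤ ε) → nndist (g x) (g y) ≤ δ) ∧
    ∀ i : Fin n, ∃ (a : Fin n → ℝ≥0) (t₁ t₂ : ℝ≥0),
      g (Function.update a i t₁) ≠ g (Function.update a i t₂)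

/-- The first modulus of continuity (4.1):
`ω(g,ε̄) = sup { |g x − g y| : x, y ∈ ℝ₊ⁿ, |x − y| ≤ ε̄ }`. -/
noncomputable def omegaMod (n : ℕ) (g : (Fin n → ℝ≥0) → ℝ≥0) (ε : Fin n → ℝ≥0) : ℝ≥0 :=
  sSup {s : ℝ≥0 | ∃ x y : Fin n → ℝ≥0,
    (∀ i, nndist (x i) (y i) ≤ ε i) ∧ s = nndist (g x) (g y)}


universe u

theorem aux_le (x y c : ℝ≥0) : nndist x y ≤ c ↔ x ≤ y + c ∧ y ≤ x + c := by
  rw [← NNReal.coe_le_coe, coe_nndist, NNReal.dist_eq, abs_le]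
  rw [← NNReal.coe_le_coe, ← NNReal.coe_le_coe]
  push_cast
  constructor
  · rintro ⟨h1, h2⟩; constructor <;> linarith
  · rintro ⟨h1, h2⟩; constructor <;> linarith

theorem aux_mid (x y a b : ℝ≥0) (h : nndist x y ≤ a + b) :
    ∃ z, nndist x z ≤ a ∧ nndist z y ≤ b := by
  rw [aux_le] at h
  obtain ⟨h1, h2⟩ := h
  rcases le_total x y with hxy | hxy
  · refine ⟨min (x + a) y, ?_, ?_⟩
    · rw [aux_le]
      refine ⟨?_, min_le_left _ _⟩
      exact le_add_right (le_min (le_add_right le_rfl) hxy)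
    · rw [aux_le]
      refine ⟨le_add_right (min_le_right _ _), ?_⟩
      rw [min_add]
      exact le_min (by rw [add_assoc]; exact h2) (le_add_right le_rfl)
  · refine ⟨max (x - a) y, ?_, ?_⟩
    · rw [aux_le]
      refine ⟨?_, le_add_right (max_le tsub_le_self hxy)⟩
      exact le_trans le_tsub_add (add_le_add_left (le_max_left _ _) a)
    · rw [aux_le]
      refine ⟨max_le ?_ (le_add_right le_rfl), le_add_right (le_max_right _ _)⟩
      rw [tsub_le_iff_right, add_assoc, add_comm b a]
      exact h1

section omega

variable {n : ℕ} {g : (Fin n → ℝ≥0) → ℝ≥0}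

theorem aux_bdd (hg : MemW n g) (ε : Fin n → ℝ≥0) :
    BddAbove {s : ℝ≥0 | ∃ x y : Fin n → ℝ≥0,
      (∀ i, nndist (x i) (y i) ≤ ε i) ∧ s = nndist (g x) (g y)} := by
  obtain ⟨δ, hδ⟩ := hg.1 (∑ i, ε i)
  refine ⟨δ, ?_⟩
  rintro s ⟨x, y, h, rfl⟩
  exact hδ x y fun i => (h i).trans
    (Finset.single_le_sum (f := ε) (fun _ _ => zero_le) (Finset.mem_univ i))

theorem aux_le_omega (hg : MemW n g) {ε x y : Fin n → ℝ≥0}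
    (h : ∀ i, nndist (x i) (y i) ≤ ε i) : nndist (g x) (g y) ≤ omegaMod n g ε :=
  le_csSup (aux_bdd hg ε) ⟨x, y, h, rfl⟩

theorem aux_omega_le {ε : Fin n → ℝ≥0} {c : ℝ≥0}
    (H : ∀ x y : Fin n → ℝ≥0, (∀ i, nndist (x i) (y i) ≤ ε i) → nndist (g x) (g y) ≤ c) :
    omegaMod n g ε ≤ c := by
  apply csSup_le
  · exact ⟨_, 0, 0, fun i => by simp, rfl⟩
  · rintro s ⟨x, y, h, rfl⟩
    exact H x y h

theorem aux_mono (hg : MemW n g) : Monotone (omegaMod n g) := fun _ _ hab =>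
  aux_omega_le fun _ _ h => aux_le_omega hg fun i => (h i).trans (hab i)

theorem aux_zero : omegaMod n g 0 = 0 := by
  apply le_antisymm _ zero_le
  apply aux_omega_le
  intro x y h
  have : x = y := by
    funext i
    have := h i
    simpa using this
  simp [this]

theorem aux_add (hg : MemW n g) (a b : Fin n → ℝ≥0) :
    omegaMod n g (a + b) ≤ omegaMod n g a + omegaMod n g b := by
  apply aux_omega_le
  intro x y h
  choose z hz1 hz2 using fun i => aux_mid (x i) (y i) (a i) (b i) (h i)
  exact (nndist_triangle _ (g z) _).trans
    (add_le_add (aux_le_omega hg hz1) (aux_le_omega hg hz2))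

theorem aux_smul (hg : MemW n g) (a : Fin n → ℝ≥0) (h : omegaMod n g a = 0) (k : ℕ) :
    omegaMod n g (k • a) = 0 := by
  induction k with
  | zero => simpa using aux_zero
  | succ k ih =>
    have := aux_add hg (k • a) a
    rw [ih, h, ← succ_nsmul] at this
    simpa using this

theorem aux_pos (hg : MemW n g) (a : Fin n → ℝ≥0) (h : omegaMod n g a = 0) : a = 0 := by
  by_contra hne
  obtain ⟨i, hi⟩ := Function.ne_iff.mp hne
  obtain ⟨v, t₁, t₂, ht⟩ := hg.2 i
  obtain ⟨k, hk⟩ := Archimedean.arch (nndist t₁ t₂) (pos_iff_ne_zero.mpr hi)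
  apply ht
  have := aux_le_omega hg (ε := k • a) (x := Function.update v i t₁)
    (y := Function.update v i t₂) (by
      intro j
      by_cases hj : j = i
      · subst hj; simpa using hk
      · simp [hj])
  rw [aux_smul hg a h] at this
  simpa using this

end omega

theorem aux_fwd (n : ℕ) (F : (Fin n → ℝ≥0) → ℝ≥0) (hm : Monotone F)
    (hF : MetricPreserving.{u} n F) :
    F 0 = 0 ∧ (∀ a, F a = 0 → a = 0) ∧ ∀ a b, F (a + b) ≤ F a + F b := by
  obtain ⟨-, h0, -, ht⟩ := hF (fun _ => ULift.{u} ℝ≥0)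
  have key : ∀ a : Fin n → ℝ≥0, F (fun i => nndist (ULift.up.{u} (a i)) (ULift.up 0)) = F a := by
    intro a
    congr 1
    funext i
    simp [ULift.nndist_up_up]
  refine ⟨?_, ?_, ?_⟩
  · have := (h0 (fun _ => ⟨0⟩) (fun _ => ⟨0⟩)).2 rfl
    rw [← key 0]
    exact NNReal.coe_eq_zero.1 this
  · intro a ha
    rw [← key a] at ha
    have := (h0 (fun i => ⟨a i⟩) (fun _ => ⟨0⟩)).1 (NNReal.coe_eq_zero.2 ha)
    funext i
    exact congrArg ULift.down (congrFun this i)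
  · intro a b
    have := ht (fun i => ⟨a i + b i⟩) (fun i => ⟨b i⟩) (fun _ => ⟨0⟩)
    have e : F (fun i => nndist (ULift.up.{u} (a i + b i)) (ULift.up (b i))) = F a := by
      congr 1
      funext i
      apply NNReal.coe_injective
      simp [ULift.nndist_up_up, NNReal.dist_eq]
    have k1 := key (a + b)
    have k2 := key b
    simp only [Pi.add_apply] at k1
    simp only [e, k1, k2] at this
    exact_mod_cast this

/-- Theorem 4.3. A function `F : ℝ₊ⁿ → ℝ₊` is an isotone metric
preserving function iff there is `g ∈ 𝒲` with `F(ε̄) = ω(g,ε̄)` for every `ε̄ ∈ ℝ₊ⁿ`. -/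
theorem stmt_14 (n : ℕ) (hn : 0 < n) (F : (Fin n → ℝ≥0) → ℝ≥0) :
    (Monotone F ∧ MetricPreserving n F) ↔
      ∃ g : (Fin n → ℝ≥0) → ℝ≥0, MemW n g ∧ ∀ ε : Fin n → ℝ≥0, F ε = omegaMod n g ε := by
  constructor
  · rintro ⟨hm, hF⟩
    obtain ⟨h0, hp, ha⟩ := aux_fwd n F hm hF
    have key : ∀ ε x y : Fin n → ℝ≥0, (∀ i, nndist (x i) (y i) ≤ ε i) →
        nndist (F x) (F y) ≤ F ε := by
      intro ε x y h
      rw [aux_le]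
      constructor
      · exact (hm (fun i => ((aux_le _ _ _).1 (h i)).1 : x ≤ y + ε)).trans (ha _ _)
      · exact (hm (fun i => ((aux_le _ _ _).1 (h i)).2 : y ≤ x + ε)).trans (ha _ _)
    refine ⟨F, ⟨fun ε => ⟨F fun _ => ε, fun x y h => key _ x y h⟩, fun i => ⟨0, 1, 0, ?_⟩⟩, ?_⟩
    · intro h
      have e : Function.update (0 : Fin n → ℝ≥0) i 0 = 0 := Function.update_eq_self i _
      rw [e, h0] at h
      have := congrFun (hp _ h) i
      simp at this
    · intro ε
      apply le_antisymm
      · apply le_csSup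
        · refine ⟨F ε, ?_⟩
          rintro s ⟨x, y, h, rfl⟩
          exact key _ _ _ h
        · exact ⟨ε, 0, fun i => by simp, by simp [h0]⟩
      · exact aux_omega_le (key ε)
  · rintro ⟨g, hg, hF⟩
    obtain rfl : F = omegaMod n g := funext hF
    refine ⟨aux_mono hg, ?_⟩
    intro Y _
    refine ⟨fun x y => NNReal.coe_nonneg _, fun x y => ?_, fun x y => ?_, fun x y z => ?_⟩
    · constructor
      · intro h
        have := aux_pos hg _ (NNReal.coe_eq_zero.1 h)
        funext i
        simpa using congrFun this i
      · rintro rfl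
        have : (fun i => nndist (x i) (x i)) = (0 : Fin n → ℝ≥0) := by funext i; simp
        simp only [this, aux_zero, NNReal.coe_zero]
    · simp only [nndist_comm]
    · have h1 := aux_mono hg (fun i => nndist_triangle (x i) (y i) (z i) :
        (fun i => nndist (x i) (z i)) ≤
          (fun i => nndist (x i) (y i)) + (fun i => nndist (y i) (z i)))
      exact_mod_cast h1.trans (aux_add hg _ _)
end

section
/- Let n be a positive integer. The set of isotone metric preserving functions F : ℝ₊ⁿ → ℝ₊ coincides with the set of fixed points of the mapping g ↦ ω(g,·) on the family 𝒲; that is, a function F : ℝ₊ⁿ → ℝ₊ is an isotone metric preserving function if and only if F ∈ 𝒲 and F(ε̄) = ω(F,ε̄) for every ε̄ ∈ ℝ₊ⁿ. -/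
open scoped NNReal

lemma nnd_le_iff (a b c : ℝ≥0) : nndist a b ≤ c ↔ a ≤ b + c ∧ b ≤ a + c := by
  rw [← NNReal.coe_le_coe, coe_nndist, NNReal.dist_eq, abs_le]
  constructor
  · rintro ⟨h1, h2⟩
    constructor <;> rw [← NNReal.coe_le_coe] <;> push_cast <;> linarith
  · rintro ⟨h1, h2⟩
    rw [← NNReal.coe_le_coe] at h1 h2
    push_cast at h1 h2
    constructor <;> linarith

/-- Corollary 4.4. The isotone metric preserving functions
`F : ℝ₊ⁿ → ℝ₊` are exactly the fixed points of the map `g ↦ ω(g,·)` on `𝒲`: `F` is an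
isotone metric preserving function iff `F ∈ 𝒲` and `F(ε̄) = ω(F,ε̄)` for every `ε̄`. -/
theorem stmt_15 (n : ℕ) (hn : 0 < n) (F : (Fin n → ℝ≥0) → ℝ≥0) :
    (Monotone F ∧ MetricPreserving n F) ↔
      (MemW n F ∧ ∀ ε : Fin n → ℝ≥0, F ε = omegaMod n F ε) := by
  constructor
  · rintro ⟨hm, hp⟩
    obtain ⟨-, h0, -, htri⟩ := hp (fun _ => ULift ℝ≥0)
    have hz : F 0 = 0 := by
      have := (h0 (fun _ => ⟨0⟩) (fun _ => ⟨0⟩)).2 rfl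
      simp only [nndist_self] at this
      exact_mod_cast this
    have hpos : ∀ a, F a = 0 → a = 0 := by
      intro a ha
      have := (h0 (fun i => ⟨a i⟩) (fun _ => ⟨0⟩)).1 (by
        change ((F fun i => nndist (a i) 0 : ℝ≥0) : ℝ) = 0
        simp only [NNReal.nndist_zero_eq_val']
        exact_mod_cast ha)
      funext i
      exact congrArg ULift.down (congrFun this i)
    have hsub : ∀ a b, F (a + b) ≤ F a + F b := by
      intro a b
      have := htri (fun i => ⟨0⟩) (fun i => ⟨a i⟩) (fun i => ⟨a i + b i⟩)
      have hab : ∀ x y : ℝ≥0, nndist x (x + y) = y := by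
        intro x y
        apply NNReal.eq
        simp [NNReal.dist_eq]
      change ((F fun i => nndist 0 (a i + b i) : ℝ≥0) : ℝ) ≤
        ((F fun i => nndist 0 (a i) : ℝ≥0) : ℝ) +
        ((F fun i => nndist (a i) (a i + b i) : ℝ≥0) : ℝ) at this
      simp only [NNReal.nndist_zero_eq_val, hab] at this
      exact_mod_cast this
    have key : ∀ x y, nndist (F x) (F y) ≤ F (fun i => nndist (x i) (y i)) := by
      intro x y
      rw [nnd_le_iff]
      exact ⟨(hm fun i => ((nnd_le_iff _ _ _).1 le_rfl).1).trans (hsub y _),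
        (hm fun i => ((nnd_le_iff _ _ _).1 le_rfl).2).trans (hsub x _)⟩
    refine ⟨⟨fun ε => ⟨F fun _ => ε, fun x y h => (key x y).trans (hm h)⟩, fun i => ?_⟩, ?_⟩
    · refine ⟨0, 0, 1, fun h => ?_⟩
      have h1 : Function.update (0 : Fin n → ℝ≥0) i 0 = 0 := by simp
      rw [h1, hz] at h
      have := congrFun (hpos _ h.symm) i
      simp at this
    · intro ε
      symm
      refine IsGreatest.csSup_eq ⟨⟨ε, 0, fun i => by simp, by simp [hz]⟩, ?_⟩
      rintro s ⟨x, y, h, rfl⟩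
      exact (key x y).trans (hm h)
  · rintro ⟨⟨hb, hv⟩, hF⟩
    have key' : ∀ ε x y, (∀ i, nndist (x i) (y i) ≤ ε i) → nndist (F x) (F y) ≤ F ε := by
      intro ε x y h
      rw [hF ε]
      refine le_csSup ?_ ⟨x, y, h, rfl⟩
      obtain ⟨δ, hδ⟩ := hb (∑ i, ε i)
      refine ⟨δ, ?_⟩
      rintro s ⟨x, y, h, rfl⟩
      exact hδ x y fun i => (h i).trans
        (Finset.single_le_sum (f := ε) (fun _ _ => zero_le) (Finset.mem_univ i))
    have key : ∀ x y, nndist (F x) (F y) ≤ F (fun i => nndist (x i) (y i)) :=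
      fun x y => key' _ x y fun i => le_rfl
    have hz : F 0 = 0 := by
      rw [hF 0, ← nonpos_iff_eq_zero]
      refine csSup_le ⟨_, 0, 0, by simp, rfl⟩ ?_
      rintro s ⟨x, y, h, rfl⟩
      have : x = y := funext fun i => by simpa using h i
      simp [this]
    have hm : Monotone F := by
      intro a b hab
      have := key' b a 0 (fun i => by simpa using hab i)
      simpa [hz] using this
    have hsub : ∀ a b, F (a + b) ≤ F a + F b := by
      intro a b
      refine ((nnd_le_iff _ _ _).1 (key' b (a + b) a fun i => ?_)).1
      rw [nnd_le_iff]
      refine ⟨le_rfl, ?_⟩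
      simp only [Pi.add_apply, add_assoc]
      exact le_self_add
    have hpos : ∀ a, F a = 0 → a = 0 := by
      intro a ha
      by_contra hne
      obtain ⟨i, hi⟩ := Function.ne_iff.1 hne
      have hk : ∀ k : ℕ, F (k • a) = 0 := by
        intro k
        induction k with
        | zero => simpa using hz
        | succ k ih =>
          rw [succ_nsmul, ← nonpos_iff_eq_zero]
          have h := hsub (k • a) a
          rwa [ih, ha, add_zero] at h
      obtain ⟨c, t₁, t₂, hc⟩ := hv i
      apply hc
      obtain ⟨k, hk'⟩ := Archimedean.arch (nndist t₁ t₂) (pos_iff_ne_zero.2 hi)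
      have h := key' (k • a) (Function.update c i t₁) (Function.update c i t₂) (by
        intro j
        by_cases hj : j = i
        · subst hj
          simpa using hk'
        · simp [Function.update_of_ne hj])
      rw [hk k] at h
      simpa using h
    refine ⟨hm, fun Y _ => ⟨fun x y => NNReal.coe_nonneg _, fun x y => ?_, fun x y => ?_,
      fun x y z => ?_⟩⟩
    · constructor
      · intro h
        have := hpos _ (NNReal.coe_eq_zero.1 h)
        funext i
        simpa using congrFun this i
      · rintro rfl
        simp only [nndist_self]
        exact_mod_cast hz
    · simp only [nndist_comm]
    · have := (hm (fun i => nndist_triangle (x i) (y i) (z i))).trans (hsub _ _)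
      exact_mod_cast this
end
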